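/- arXiv:1905.07544 — 2 statements merged into one kernel-verified Lean document; each statement's English description precedes it below -/
import Mathlib

section
/- In the dynamic model, assume F_i has a continuous bounded density f_i and w_i is continuous. Fix i ∈ {1,2}, j ≠ i, an open measurable σ_j ⊆ (0,∞), an open measurable σ⁰ ⊆ (0,∞), and 0 ≤ ℓ < U with σ⁰ ∩ (ℓ, U] = ∅. For u ∈ (ℓ, U) let σ_i(u) = σ⁰ ∪ (ℓ, u) and G(u) = R(w, σ) with state-i policy σ_i(u) and state-j policy σ_j. Then G is differentiable at every u ∈ (ℓ, U) with G′(u) = [λ_i·f_i(u)/(Q_i·T_j + Q_j·T_i)]·[q_{i→j}(u)·W_j + Q_j·w_i(u) − G(u)·(u·Q_j + q_{i→j}(u)·T_j)], where Q_i, T_i, W_i are evaluated at σ_i(u) and Q_j, T_j, W_j at σ_j. Moreover, at every u with f_i(u) > 0, G′(u) has the same sign as r(u) = (q_{i→j}(u)/u)·(R_j − R_i) + (w_i(u)/u)·(Q_i/T_i + Q_j/T_j) − (Q_i/T_i·R_j + Q_j/T_j·R_i). -/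
open MeasureTheory Set

/-- `q(s)` for transition rates `a` (from the current state) and `b` (back). -/
noncomputable def qfun (a b s : ℝ) : ℝ := a / (a + b) * (1 - Real.exp (-(a + b) * s))

/-- `Q(σ) = λ_{i→j} + λ ∫_σ q_{i→j}(τ) f(τ) dτ` (density form). -/
noncomputable def Qd (a b lam : ℝ) (f : ℝ → ℝ) (σ : Set ℝ) : ℝ :=
  a + lam * ∫ τ in σ, qfun a b τ * f τ

/-- `T(σ) = 1 + λ ∫_σ τ f(τ) dτ` (density form). -/
noncomputable def Td (lam : ℝ) (f : ℝ → ℝ) (σ : Set ℝ) : ℝ :=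
  1 + lam * ∫ τ in σ, τ * f τ

/-- `W(σ) = λ ∫_σ w(τ) f(τ) dτ` (density form). -/
noncomputable def Wd (lam : ℝ) (f w : ℝ → ℝ) (σ : Set ℝ) : ℝ :=
  lam * ∫ τ in σ, w τ * f τ

/-- Driver's long-run earnings rate in the dynamic model (density form), with the
current state denoted `I` and the other state `J`. -/
noncomputable def Rd (lamI lamJ lamIJ lamJI : ℝ) (fI fJ wI wJ : ℝ → ℝ)
    (σI σJ : Set ℝ) : ℝ :=
  (Qd lamJI lamIJ lamJ fJ σJ * Wd lamI fI wI σI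
      + Qd lamIJ lamJI lamI fI σI * Wd lamJ fJ wJ σJ) /
  (Qd lamJI lamIJ lamJ fJ σJ * Td lamI fI σI
      + Qd lamIJ lamJI lamI fI σI * Td lamJ fJ σJ)

theorem qfun_nonneg {a b s : ℝ} (ha : 0 < a) (hb : 0 < b) (hs : 0 ≤ s) : 0 ≤ qfun a b s := by
  have h : Real.exp (-(a + b) * s) ≤ 1 := Real.exp_le_one_iff.2 (by nlinarith)
  exact mul_nonneg (by positivity) (by linarith)

theorem qfun_le_one {a b s : ℝ} (ha : 0 < a) (hb : 0 < b) : qfun a b s ≤ 1 := by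
  have h := Real.exp_pos (-(a + b) * s)
  have h' : a / (a + b) ≤ 1 := by rw [div_le_one (by positivity)]; linarith
  have h'' : 0 < a / (a + b) := by positivity
  unfold qfun
  nlinarith

theorem continuous_qfun (a b : ℝ) : Continuous (qfun a b) := by
  unfold qfun
  fun_prop

theorem qfun_mul_nonneg {a b : ℝ} (ha : 0 < a) (hb : 0 < b) {f : ℝ → ℝ}
    (hf : ∀ x, 0 ≤ f x) (hsupp : ∀ x ≤ (0 : ℝ), f x = 0) (x : ℝ) : 0 ≤ qfun a b x * f x := by
  rcases le_total x 0 with hx | hx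
  · simp [hsupp x hx]
  · exact mul_nonneg (qfun_nonneg ha hb hx) (hf x)

theorem integrable_qfun_mul {a b : ℝ} (ha : 0 < a) (hb : 0 < b) {f : ℝ → ℝ}
    (hf : ∀ x, 0 ≤ f x) (hsupp : ∀ x ≤ (0 : ℝ), f x = 0) (hint : Integrable f) :
    Integrable (fun x => qfun a b x * f x) := by
  refine hint.mono ((continuous_qfun a b).aestronglyMeasurable.mul hint.aestronglyMeasurable)
    (.of_forall fun x => ?_)
  rw [Real.norm_of_nonneg (qfun_mul_nonneg ha hb hf hsupp x), Real.norm_of_nonneg (hf x)]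
  exact mul_le_of_le_one_left (hf x) (qfun_le_one ha hb)

theorem Qd_pos {a b lam : ℝ} (ha : 0 < a) (hb : 0 < b) (hlam : 0 < lam) {f : ℝ → ℝ}
    (hf : ∀ x, 0 ≤ f x) (hsupp : ∀ x ≤ (0 : ℝ), f x = 0) (σ : Set ℝ) : 0 < Qd a b lam f σ :=
  add_pos_of_pos_of_nonneg ha
    (mul_nonneg hlam.le (integral_nonneg (qfun_mul_nonneg ha hb hf hsupp)))

theorem Td_pos {lam : ℝ} (hlam : 0 < lam) {f : ℝ → ℝ}
    (hf : ∀ x, 0 ≤ f x) (hsupp : ∀ x ≤ (0 : ℝ), f x = 0) (σ : Set ℝ) : 0 < Td lam f σ := by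
  refine add_pos_of_pos_of_nonneg one_pos (mul_nonneg hlam.le (integral_nonneg fun x => ?_))
  rcases le_total x 0 with hx | hx
  · simp [hsupp x hx]
  · exact mul_nonneg hx (hf x)

/-- The integral over `σ ∪ (ℓ, v)` is differentiable in the endpoint `v` as long as the interval
does not meet `σ`. -/
theorem hasDerivAt_setIntegral_union_Ioo {g : ℝ → ℝ} (hg : Continuous g) (hint : Integrable g)
    {σ : Set ℝ} {ℓ U : ℝ} (hdisj : σ ∩ Ioc ℓ U = ∅) {u : ℝ} (hu : u ∈ Ioo ℓ U) :
    HasDerivAt (fun v => ∫ x in σ ∪ Ioo ℓ v, g x) (g u) u := by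
  have h : HasDerivAt (fun v => (∫ x in σ, g x) + ∫ x in ℓ..v, g x) (g u) u :=
    (intervalIntegral.integral_hasDerivAt_right (hg.intervalIntegrable _ _)
      (hg.stronglyMeasurableAtFilter _ _) hg.continuousAt).const_add _
  refine h.congr_of_eventuallyEq ?_
  filter_upwards [Ioo_mem_nhds hu.1 hu.2] with v hv
  have hd : Disjoint σ (Ioo ℓ v) :=
    (disjoint_iff_inter_eq_empty.2 hdisj).mono_right
      (Ioo_subset_Ioc_self.trans (Ioc_subset_Ioc_right hv.2.le))
  rw [setIntegral_union hd measurableSet_Ioo hint.integrableOn hint.integrableOn,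
    intervalIntegral.integral_of_le hv.1.le, integral_Ioc_eq_integral_Ioo]

/-- The reward is differentiable in an upper endpoint `u` of the state-`i` policy, with
the stated derivative; moreover wherever `f_i(u) > 0` the derivative has the same sign
as `r(u) = (q_{i→j}(u)/u)(R_j − R_i) + (w_i(u)/u)(Q_i/T_i + Q_j/T_j)
− (Q_i/T_i·R_j + Q_j/T_j·R_i)`. -/
theorem reward_endpoint_derivative
    (lamI lamJ lamIJ lamJI : ℝ)
    (hlamI : 0 < lamI) (hlamJ : 0 < lamJ) (hlamIJ : 0 < lamIJ) (hlamJI : 0 < lamJI)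
    (fI fJ : ℝ → ℝ) (hfIc : Continuous fI) (hfJc : Continuous fJ)
    (hfIb : ∃ M, ∀ x, fI x ≤ M) (hfJb : ∃ M, ∀ x, fJ x ≤ M)
    (hfInn : ∀ x, 0 ≤ fI x) (hfJnn : ∀ x, 0 ≤ fJ x)
    (hfIsupp : ∀ x ≤ (0 : ℝ), fI x = 0) (hfJsupp : ∀ x ≤ (0 : ℝ), fJ x = 0)
    (hfIprob : ∫ x, fI x = 1) (hfJprob : ∫ x, fJ x = 1)
    (hfImean : Integrable (fun x => x * fI x)) (hfJmean : Integrable (fun x => x * fJ x))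
    (wI wJ : ℝ → ℝ) (hwIc : Continuous wI) (hwJc : Continuous wJ)
    (hwInn : ∀ x, 0 ≤ wI x) (hwJnn : ∀ x, 0 ≤ wJ x)
    (hwIint : Integrable (fun x => wI x * fI x))
    (hwJint : Integrable (fun x => wJ x * fJ x))
    (σJ : Set ℝ) (hσJopen : IsOpen σJ) (hσJsub : σJ ⊆ Ioi 0)
    (σ0 : Set ℝ) (hσ0open : IsOpen σ0) (hσ0sub : σ0 ⊆ Ioi 0)
    (ℓ U : ℝ) (hℓ : 0 ≤ ℓ) (hℓU : ℓ < U) (hdisj : σ0 ∩ Ioc ℓ U = ∅) :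
    ∀ u ∈ Ioo ℓ U,
      let σIu : Set ℝ := σ0 ∪ Ioo ℓ u
      let QI : ℝ := Qd lamIJ lamJI lamI fI σIu
      let TI : ℝ := Td lamI fI σIu
      let WI : ℝ := Wd lamI fI wI σIu
      let QJ : ℝ := Qd lamJI lamIJ lamJ fJ σJ
      let TJ : ℝ := Td lamJ fJ σJ
      let WJ : ℝ := Wd lamJ fJ wJ σJ
      let G : ℝ → ℝ := fun v => Rd lamI lamJ lamIJ lamJI fI fJ wI wJ (σ0 ∪ Ioo ℓ v) σJ
      let Dval : ℝ := lamI * fI u / (QI * TJ + QJ * TI) *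
        (qfun lamIJ lamJI u * WJ + QJ * wI u
          - G u * (u * QJ + qfun lamIJ lamJI u * TJ))
      let rval : ℝ := qfun lamIJ lamJI u / u * (WJ / TJ - WI / TI)
        + wI u / u * (QI / TI + QJ / TJ)
        - (QI / TI * (WJ / TJ) + QJ / TJ * (WI / TI))
      HasDerivAt G Dval u ∧
        (0 < fI u → ((0 < Dval ↔ 0 < rval) ∧ (Dval < 0 ↔ rval < 0))) := by
  intro u hu σIu QI TI WI QJ TJ WJ G Dval rval
  have hu0 : 0 < u := hℓ.trans_lt hu.1
  have hfI : Integrable fI := .of_integral_ne_zero (by simp [hfIprob])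
  have hQI : 0 < QI := Qd_pos hlamIJ hlamJI hlamI hfInn hfIsupp _
  have hQJ : 0 < QJ := Qd_pos hlamJI hlamIJ hlamJ hfJnn hfJsupp _
  have hTI : 0 < TI := Td_pos hlamI hfInn hfIsupp _
  have hTJ : 0 < TJ := Td_pos hlamJ hfJnn hfJsupp _
  have hD : 0 < QJ * TI + QI * TJ := by positivity
  have hGu : G u = (QJ * WI + QI * WJ) / (QJ * TI + QI * TJ) := rfl
  have hQ' : HasDerivAt (fun v => Qd lamIJ lamJI lamI fI (σ0 ∪ Ioo ℓ v))
      (lamI * (qfun lamIJ lamJI u * fI u)) u :=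
    ((hasDerivAt_setIntegral_union_Ioo ((continuous_qfun _ _).mul hfIc)
      (integrable_qfun_mul hlamIJ hlamJI hfInn hfIsupp hfI) hdisj hu).const_mul lamI).const_add _
  have hT' : HasDerivAt (fun v => Td lamI fI (σ0 ∪ Ioo ℓ v)) (lamI * (u * fI u)) u :=
    ((hasDerivAt_setIntegral_union_Ioo (continuous_id.mul hfIc) hfImean hdisj hu).const_mul
      lamI).const_add _
  have hW' : HasDerivAt (fun v => Wd lamI fI wI (σ0 ∪ Ioo ℓ v)) (lamI * (wI u * fI u)) u :=
    (hasDerivAt_setIntegral_union_Ioo (hwIc.mul hfIc) hwIint hdisj hu).const_mul lamI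
  refine ⟨?_, fun hf => ?_⟩
  · have h := ((hW'.const_mul QJ).add (hQ'.mul_const WJ)).div
      ((hT'.const_mul QJ).add (hQ'.mul_const TJ)) hD.ne'
    refine h.congr_deriv ?_
    change ((QJ * (lamI * (wI u * fI u)) + lamI * (qfun lamIJ lamJI u * fI u) * WJ) *
        (QJ * TI + QI * TJ) - (QJ * WI + QI * WJ) *
        (QJ * (lamI * (u * fI u)) + lamI * (qfun lamIJ lamJI u * fI u) * TJ)) /
        (QJ * TI + QI * TJ) ^ 2 = lamI * fI u / (QI * TJ + QJ * TI) *
        (qfun lamIJ lamJI u * WJ + QJ * wI u - G u * (u * QJ + qfun lamIJ lamJI u * TJ))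
    rw [hGu, add_comm (QI * TJ)]
    field_simp
    ring
  · have key : Dval =
        lamI * fI u * QJ * u * TI * TJ / (QJ * TI + QI * TJ) ^ 2 * rval := by
      change lamI * fI u / (QI * TJ + QJ * TI) *
        (qfun lamIJ lamJI u * WJ + QJ * wI u - G u * (u * QJ + qfun lamIJ lamJI u * TJ)) =
        lamI * fI u * QJ * u * TI * TJ / (QJ * TI + QI * TJ) ^ 2 *
        (qfun lamIJ lamJI u / u * (WJ / TJ - WI / TI) + wI u / u * (QI / TI + QJ / TJ)
          - (QI / TI * (WJ / TJ) + QJ / TJ * (WI / TI)))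
      rw [hGu, add_comm (QI * TJ)]
      field_simp
      ring
    have hc : 0 < lamI * fI u * QJ * u * TI * TJ / (QJ * TI + QI * TJ) ^ 2 := by positivity
    rw [key]
    exact ⟨mul_pos_iff_of_pos_left hc, smul_neg_iff_of_pos_left hc⟩
end

section
/- Multiplicative pricing is not incentive compatible in the dynamic model: there exist primitives (rates λ₁, λ₂, λ_{1→2}, λ_{2→1} > 0, atomless trip-length distributions F₁, F₂ on (0,∞) with bounded densities and finite means, and multipliers m₁, m₂ > 0) satisfying surge dominance such that, with multiplicative pricing w_i(τ) = m_i·τ, the all-accepting policy {(0,∞), (0,∞)} is not optimal: there exists a pair σ' of open measurable subsets of (0,∞) with R(w, σ') > R(w, {(0,∞), (0,∞)}). -/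
open MeasureTheory Set

/-- `Q_i(σ) = λ_{i→j} + λ_i ∫_σ q_{i→j}(τ) dF(τ)`. -/
noncomputable def Qfun (a b lam : ℝ) (F : Measure ℝ) (σ : Set ℝ) : ℝ :=
  a + lam * ∫ τ in σ, qfun a b τ ∂F

/-- `T_i(σ) = 1 + λ_i ∫_σ τ dF(τ)`. -/
noncomputable def Tfun (lam : ℝ) (F : Measure ℝ) (σ : Set ℝ) : ℝ :=
  1 + lam * ∫ τ in σ, τ ∂F

/-- `W_i(σ) = λ_i ∫_σ w(τ) dF(τ)`. -/
noncomputable def Wfun (lam : ℝ) (F : Measure ℝ) (w : ℝ → ℝ) (σ : Set ℝ) : ℝ :=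
  lam * ∫ τ in σ, w τ ∂F

/-- Driver's long-run earnings rate in the dynamic model. -/
noncomputable def Rdyn (lam1 lam2 lam12 lam21 : ℝ) (F1 F2 : Measure ℝ)
    (w1 w2 : ℝ → ℝ) (σ1 σ2 : Set ℝ) : ℝ :=
  (Qfun lam21 lam12 lam2 F2 σ2 * Wfun lam1 F1 w1 σ1
      + Qfun lam12 lam21 lam1 F1 σ1 * Wfun lam2 F2 w2 σ2) /
  (Qfun lam21 lam12 lam2 F2 σ2 * Tfun lam1 F1 σ1
      + Qfun lam12 lam21 lam1 F1 σ1 * Tfun lam2 F2 σ2)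

theorem restrict_Ioc_restrict_Ioi_zero :
    ((volume : Measure ℝ).restrict (Ioc 2 3)).restrict (Ioi 0) = volume.restrict (Ioc 2 3) := by
  rw [Measure.restrict_restrict measurableSet_Ioi]
  congr 1
  ext x
  simp only [mem_inter_iff, mem_Ioi, mem_Ioc]
  exact ⟨And.right, fun h => ⟨by linarith [h.1], h⟩⟩

theorem setIntegral_id_Ioc_two_three : ∫ τ in Ioc (2 : ℝ) 3, τ = 5 / 2 := by
  rw [← intervalIntegral.integral_of_le (by norm_num), integral_id]
  norm_num

theorem Wfun_const_mul (lam m : ℝ) (F : Measure ℝ) (σ : Set ℝ) :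
    Wfun lam F (fun τ => m * τ) σ = lam * (m * ∫ τ in σ, τ ∂F) := by
  rw [Wfun, integral_const_mul]

theorem abs_qfun_one_one_le {s : ℝ} (hs : 0 ≤ s) : |qfun 1 1 s| ≤ 1 / 2 := by
  have hle : Real.exp (-(1 + 1) * s) ≤ 1 := Real.exp_le_one_iff.2 (by linarith)
  have hpos := Real.exp_pos (-(1 + 1) * s)
  rw [qfun, one_add_one_eq_two, abs_le]
  rw [one_add_one_eq_two] at hle hpos
  constructor <;> linarith

theorem abs_setIntegral_qfun_Ioc_le : |∫ τ in Ioc (2 : ℝ) 3, qfun 1 1 τ| ≤ 1 / 2 := by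
  rw [← intervalIntegral.integral_of_le (by norm_num)]
  have h : ‖∫ τ in (2 : ℝ)..3, qfun 1 1 τ‖ ≤ 1 / 2 * |3 - 2| := by
    refine intervalIntegral.norm_integral_le_of_norm_le_const fun x hx => ?_
    rw [uIoc_of_le (by norm_num)] at hx
    exact abs_qfun_one_one_le (by linarith [hx.1])
  norm_num at h ⊢
  exact h

/-- Multiplicative pricing is not incentive compatible in the dynamic model: there are
primitives satisfying surge dominance under which the all-accepting policy is strictly
beaten by another pair of open policies. -/
theorem multiplicative_pricing_not_IC :
    ∃ (lam1 lam2 lam12 lam21 m1 m2 : ℝ) (F1 F2 : Measure ℝ) (f1 f2 : ℝ → ℝ),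
      0 < lam1 ∧ 0 < lam2 ∧ 0 < lam12 ∧ 0 < lam21 ∧ 0 < m1 ∧ 0 < m2 ∧
      IsProbabilityMeasure F1 ∧ IsProbabilityMeasure F2 ∧
      NoAtoms F1 ∧ NoAtoms F2 ∧
      F1 (Iic 0) = 0 ∧ F2 (Iic 0) = 0 ∧
      Measurable f1 ∧ Measurable f2 ∧
      (∀ x, 0 ≤ f1 x) ∧ (∀ x, 0 ≤ f2 x) ∧
      (∃ M, ∀ x, f1 x ≤ M) ∧ (∃ M, ∀ x, f2 x ≤ M) ∧
      F1 = MeasureTheory.volume.withDensity (fun x => ENNReal.ofReal (f1 x)) ∧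
      F2 = MeasureTheory.volume.withDensity (fun x => ENNReal.ofReal (f2 x)) ∧
      Integrable id F1 ∧ Integrable id F2 ∧
      (∃ σ2 : Set ℝ, IsOpen σ2 ∧ σ2 ⊆ Ioi 0 ∧
        ∀ σ1 : Set ℝ, IsOpen σ1 → σ1 ⊆ Ioi 0 →
          Wfun lam1 F1 (fun τ => m1 * τ) σ1 / Tfun lam1 F1 σ1 <
            Wfun lam2 F2 (fun τ => m2 * τ) σ2 / Tfun lam2 F2 σ2) ∧
      (∃ σ1' σ2' : Set ℝ, IsOpen σ1' ∧ σ1' ⊆ Ioi 0 ∧ IsOpen σ2' ∧ σ2' ⊆ Ioi 0 ∧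
        Rdyn lam1 lam2 lam12 lam21 F1 F2 (fun τ => m1 * τ) (fun τ => m2 * τ)
            (Ioi 0) (Ioi 0)
          < Rdyn lam1 lam2 lam12 lam21 F1 F2 (fun τ => m1 * τ) (fun τ => m2 * τ)
            σ1' σ2') := by
  have hF : (volume : Measure ℝ).restrict (Ioc 2 3) = volume.withDensity
      (fun x => ENNReal.ofReal ((Ioc (2 : ℝ) 3).indicator 1 x)) := by
    rw [← withDensity_indicator_one measurableSet_Ioc]
    congr 1
    ext x
    by_cases hx : x ∈ Ioc (2 : ℝ) 3 <;> simp [hx]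
  have hprob : IsProbabilityMeasure ((volume : Measure ℝ).restrict (Ioc 2 3)) :=
    ⟨by norm_num [Real.volume_Ioc]⟩
  have hatoms : NullSingletonClass ((volume : Measure ℝ).restrict (Ioc 2 3)) := inferInstance
  have hsupp : (volume : Measure ℝ).restrict (Ioc 2 3) (Iic 0) = 0 := by
    rw [Measure.restrict_apply measurableSet_Iic]
    convert measure_empty (μ := (volume : Measure ℝ))
    ext x
    simp only [mem_inter_iff, mem_Iic, mem_Ioc, mem_empty_iff_false, iff_false]
    rintro ⟨h0, h2, -⟩
    linarith
  have hmeas : Measurable ((Ioc (2 : ℝ) 3).indicator (1 : ℝ → ℝ)) :=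
    measurable_one.indicator measurableSet_Ioc
  have hnonneg : ∀ x, 0 ≤ (Ioc (2 : ℝ) 3).indicator (1 : ℝ → ℝ) x :=
    indicator_nonneg fun _ _ => zero_le_one
  have hbdd : ∃ M, ∀ x, (Ioc (2 : ℝ) 3).indicator (1 : ℝ → ℝ) x ≤ M :=
    ⟨1, indicator_le_self' (fun _ _ => zero_le_one)⟩
  have hint : Integrable id ((volume : Measure ℝ).restrict (Ioc 2 3)) :=
    continuous_id.integrableOn_Ioc
  refine ⟨1, 1, 1, 1, 1 / 10, 1, volume.restrict (Ioc 2 3), volume.restrict (Ioc 2 3),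
    (Ioc (2 : ℝ) 3).indicator 1, (Ioc (2 : ℝ) 3).indicator 1, by norm_num, by norm_num,
    by norm_num, by norm_num, by norm_num, by norm_num, hprob, hprob, hatoms,
    hatoms, hsupp, hsupp, hmeas, hmeas, hnonneg, hnonneg, hbdd, hbdd, hF, hF, hint, hint,
    ⟨Ioi 0, isOpen_Ioi, subset_rfl, fun σ hσ hσ0 => ?_⟩,
    ⟨∅, Ioi 0, isOpen_empty, empty_subset _, isOpen_Ioi, subset_rfl, ?_⟩⟩
  · have hσ_nonneg : 0 ≤ ∫ τ in σ, τ ∂(volume.restrict (Ioc (2 : ℝ) 3)) :=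
      setIntegral_nonneg hσ.measurableSet fun x hx => (hσ0 hx).le
    simp only [Wfun_const_mul, Tfun, restrict_Ioc_restrict_Ioi_zero,
      setIntegral_id_Ioc_two_three]
    rw [div_lt_div_iff₀ (by linarith) (by norm_num)]
    linarith
  · obtain ⟨hc0, hc1⟩ := abs_le.1 abs_setIntegral_qfun_Ioc_le
    simp only [Rdyn, Qfun, Wfun_const_mul, Tfun, restrict_Ioc_restrict_Ioi_zero,
      setIntegral_id_Ioc_two_three, setIntegral_empty]
    generalize ∫ τ in Ioc (2 : ℝ) 3, qfun 1 1 τ = c at hc0 hc1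
    rw [div_lt_div_iff₀ (by linarith) (by linarith)]
    nlinarith
end
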